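/- arXiv:math/0701682 — 2 statements merged into one kernel-verified Lean document; each statement's English description precedes it below -/
import Mathlib

section
/- Let 𝔅 denote the set of coefficient families a = (a_α)_{α∈𝔽ₙ⁺} with a_{g₀} = 0, satisfying the radius-1 limsup condition, whose associated free holomorphic function f^a satisfies ‖f^a_K(X)‖ ≤ 1 for every complex Hilbert space K and every X ∈ [B(K)ⁿ]₁. Let 𝔊 denote the set of coefficient families c = (c_α)_{α∈𝔽ₙ⁺} with c_{g₀} = 0, satisfying the radius-1 limsup condition, whose associated free holomorphic function g^c satisfies g^c_K(X)* + I + g^c_K(X) ≥ 0 for every complex Hilbert space K and every X ∈ [B(K)ⁿ]₁. Then: for every a ∈ 𝔅, every K and every X ∈ [B(K)ⁿ]₁, the operator I − f^a_K(X) is invertible; there is a unique c ∈ 𝔊 such that g^c_K(X) = f^a_K(X) · (I − f^a_K(X))⁻¹ for every K and every X ∈ [B(K)ⁿ]₁; and the resulting map (the noncommutative Cayley transform) a ↦ c is a bijection from 𝔅 onto 𝔊. -/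
open scoped ENNReal ComplexOrder
open Filter ContinuousLinearMap

noncomputable section

abbrev Word (n : ℕ) := FreeMonoid (Fin n)

/-- The word determined by a tuple of letters. -/
def word {n k : ℕ} (f : Fin k → Fin n) : Word n :=
  FreeMonoid.ofList (List.ofFn f)

/-- The length of a word. -/
def wordLen {n : ℕ} (α : Word n) : ℕ := (FreeMonoid.toList α).length

/-- The product `X_α = X_{i₁} ⋯ X_{i_k}` for `α = g_{i₁} ⋯ g_{i_k}`. -/
def wordProd {n : ℕ} {K : Type} [NormedAddCommGroup K] [InnerProductSpace ℂ K]
    (X : Fin n → K →L[ℂ] K) (α : Word n) : K →L[ℂ] K :=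
  ((FreeMonoid.toList α).map X).prod

/-- `Σ_{|α| = k} a_α X_α`. -/
def truncSum {n : ℕ} {K : Type} [NormedAddCommGroup K] [InnerProductSpace ℂ K]
    (a : Word n → ℂ) (X : Fin n → K →L[ℂ] K) (k : ℕ) : K →L[ℂ] K :=
  ∑ f : Fin k → Fin n, a (word f) • wordProd X (word f)

/-- `Σ_{|α| = k} b_α X_α*`. -/
def truncSumAdj {n : ℕ} {K : Type} [NormedAddCommGroup K] [InnerProductSpace ℂ K]
    [CompleteSpace K] (b : Word n → ℂ) (X : Fin n → K →L[ℂ] K) (k : ℕ) : K →L[ℂ] K :=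
  ∑ f : Fin k → Fin n, b (word f) • adjoint (wordProd X (word f))

/-- The free holomorphic function `f(X) = Σ_k Σ_{|α| = k} a_α X_α`. -/
def holOp {n : ℕ} {K : Type} [NormedAddCommGroup K] [InnerProductSpace ℂ K]
    (a : Word n → ℂ) (X : Fin n → K →L[ℂ] K) : K →L[ℂ] K :=
  ∑' k : ℕ, truncSum a X k

/-- The free pluriharmonic function
`u(X) = Σ_{k ≥ 1} Σ_{|α| = k} b_α X_α* + a_{g₀} I + Σ_{k ≥ 1} Σ_{|α| = k} a_α X_α`. -/
def phOp {n : ℕ} {K : Type} [NormedAddCommGroup K] [InnerProductSpace ℂ K]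
    [CompleteSpace K] (a b : Word n → ℂ) (X : Fin n → K →L[ℂ] K) : K →L[ℂ] K :=
  (∑' k : ℕ, truncSumAdj b X (k + 1)) + a 1 • (1 : K →L[ℂ] K)
    + ∑' k : ℕ, truncSum a X (k + 1)

/-- Membership in the open noncommutative ball of radius `γ`. -/
def inBall {n : ℕ} {K : Type} [NormedAddCommGroup K] [InnerProductSpace ℂ K]
    [CompleteSpace K] (γ : ℝ) (X : Fin n → K →L[ℂ] K) : Prop :=
  ‖∑ i, X i * adjoint (X i)‖ < γ ^ 2

/-- Membership in the closed noncommutative ball of radius `γ`. -/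
def inClosedBall {n : ℕ} {K : Type} [NormedAddCommGroup K] [InnerProductSpace ℂ K]
    [CompleteSpace K] (γ : ℝ) (X : Fin n → K →L[ℂ] K) : Prop :=
  ‖∑ i, X i * adjoint (X i)‖ ≤ γ ^ 2

/-- The radius-`γ` condition `limsup_k (Σ_{|α|=k} |a_α|²)^{1/(2k)} ≤ 1/γ`. -/
def radCond {n : ℕ} (γ : ℝ) (a : Word n → ℂ) : Prop :=
  Filter.limsup
    (fun k : ℕ =>
      (∑ f : Fin k → Fin n, (‖a (word f)‖₊ : ℝ≥0∞) ^ 2) ^ ((1 : ℝ) / (2 * (k : ℝ))))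
    Filter.atTop ≤ ENNReal.ofReal (1 / γ)

/-- The coefficients of the radial function: `α ↦ r^{|α|} a_α`. -/
def scaleCoef {n : ℕ} (r : ℝ) (a : Word n → ℂ) : Word n → ℂ :=
  fun α => ((r : ℂ) ^ wordLen α) * a α

/-- Positivity of the free pluriharmonic function with coefficients `(a, b)` on the
noncommutative ball of radius `γ` of every complex Hilbert space. -/
def posPH {n : ℕ} (γ : ℝ) (a b : Word n → ℂ) : Prop :=
  ∀ (K : Type) [NormedAddCommGroup K] [InnerProductSpace ℂ K] [CompleteSpace K],
    ∀ X : Fin n → K →L[ℂ] K, inBall γ X → (phOp a b X).IsPositive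


/-- Coefficient families of contractive free holomorphic functions vanishing at `0`. -/
def contrHol (n : ℕ) : Set (Word n → ℂ) :=
  {a | a 1 = 0 ∧ radCond 1 a ∧
    ∀ (K : Type) [NormedAddCommGroup K] [InnerProductSpace ℂ K] [CompleteSpace K]
      (X : Fin n → K →L[ℂ] K), inBall 1 X → ‖holOp a X‖ ≤ 1}

/-- Coefficient families of free holomorphic functions `g` vanishing at `0` with
`g(X)* + I + g(X) ≥ 0` on the unit ball. -/
def posReHol (n : ℕ) : Set (Word n → ℂ) :=
  {c | c 1 = 0 ∧ radCond 1 c ∧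
    ∀ (K : Type) [NormedAddCommGroup K] [InnerProductSpace ℂ K] [CompleteSpace K]
      (X : Fin n → K →L[ℂ] K), inBall 1 X →
        (adjoint (holOp c X) + 1 + holOp c X).IsPositive}

/-- Left translate of coefficients. -/
def shiftC {n : ℕ} (i : Fin n) (a : Word n → ℂ) : Word n → ℂ :=
  fun w => a (FreeMonoid.of i * w)

/-- Square sum at level `k`. -/
def sqS {n : ℕ} (a : Word n → ℂ) (k : ℕ) : ℝ := ∑ f : Fin k → Fin n, ‖a (word f)‖ ^ 2

/-- Partial convolution. -/
def convK {n : ℕ} (k : ℕ) (a c : Word n → ℂ) : Word n → ℂ :=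
  fun w => a (FreeMonoid.ofList ((FreeMonoid.toList w).take k)) *
    c (FreeMonoid.ofList ((FreeMonoid.toList w).drop k))

lemma word_cons {n k : ℕ} (i : Fin n) (f : Fin k → Fin n) :
    word (Fin.cons i f : Fin (k+1) → Fin n) = FreeMonoid.of i * word f := by
  simp [word, List.ofFn_succ]

lemma word_zero {n : ℕ} (f : Fin 0 → Fin n) : word f = 1 := by
  simp [word]

lemma sum_cons {n k : ℕ} {M : Type*} [AddCommMonoid M] (F : (Fin (k+1) → Fin n) → M) :
    ∑ f, F f = ∑ i, ∑ f : Fin k → Fin n, F (Fin.cons i f) := by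
  rw [← (Fin.consEquiv (fun _ : Fin (k+1) => Fin n)).sum_comp, Fintype.sum_prod_type]
  rfl

lemma sqS_succ {n : ℕ} (a : Word n → ℂ) (k : ℕ) :
    sqS a (k+1) = ∑ i, sqS (shiftC i a) k := by
  simp only [sqS, sum_cons, word_cons, shiftC]

lemma sqS_nonneg {n : ℕ} (a : Word n → ℂ) (k : ℕ) : 0 ≤ sqS a k :=
  Finset.sum_nonneg fun _ _ => by positivity

section
variable {n : ℕ} {K : Type} [NormedAddCommGroup K] [InnerProductSpace ℂ K]

lemma wordProd_cons (X : Fin n → K →L[ℂ] K) (i : Fin n) (w : Word n) :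
    wordProd X (FreeMonoid.of i * w) = X i * wordProd X w := by
  simp [wordProd]

lemma truncSum_zero (a : Word n → ℂ) (X : Fin n → K →L[ℂ] K) :
    truncSum a X 0 = a 1 • 1 := by
  simp [truncSum, word_zero, wordProd]

lemma truncSum_succ (a : Word n → ℂ) (X : Fin n → K →L[ℂ] K) (k : ℕ) :
    truncSum a X (k+1) = ∑ i, X i * truncSum (shiftC i a) X k := by
  simp only [truncSum, sum_cons, word_cons, shiftC, wordProd_cons, Finset.mul_sum,
    mul_smul_comm]

lemma truncSum_smul (z : ℂ) (X : Fin n → K →L[ℂ] K) (k : ℕ) : ∀ (a : Word n → ℂ),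
    truncSum a (fun i => z • X i) k = z ^ k • truncSum a X k := by
  induction k with
  | zero => intro a; simp [truncSum_zero]
  | succ k ih =>
    intro a
    simp only [truncSum_succ, ih, Finset.smul_sum]
    refine Finset.sum_congr rfl fun i _ => ?_
    rw [smul_mul_smul_comm, pow_succ']

lemma truncSum_convK (X : Fin n → K →L[ℂ] K) (c : Word n → ℂ) (j k : ℕ) : ∀ (a : Word n → ℂ),
    truncSum (convK k a c) X (k + j) = truncSum a X k * truncSum c X j := by
  induction k with
  | zero =>
    intro a
    rw [truncSum_zero, Nat.zero_add, truncSum, truncSum, smul_mul_assoc, one_mul, Finset.smul_sum]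
    refine Finset.sum_congr rfl fun f _ => ?_
    rw [smul_smul]; rfl
  | succ k ih =>
    intro a
    rw [Nat.add_right_comm, truncSum_succ, truncSum_succ, Finset.sum_mul]
    refine Finset.sum_congr rfl fun i _ => ?_
    rw [mul_assoc, ← ih]
    rfl

lemma truncSum_congr {a b : Word n → ℂ} {k : ℕ} (h : ∀ w, wordLen w = k → a w = b w)
    (X : Fin n → K →L[ℂ] K) : truncSum a X k = truncSum b X k := by
  unfold truncSum
  refine Finset.sum_congr rfl fun f _ => ?_
  rw [h _ (by simp [word, wordLen])]

lemma truncSum_sum {ι : Type*} (s : Finset ι) (a : ι → Word n → ℂ) (k : ℕ)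
    (X : Fin n → K →L[ℂ] K) :
    truncSum (fun w => ∑ i ∈ s, a i w) X k = ∑ i ∈ s, truncSum (a i) X k := by
  simp only [truncSum, Finset.sum_smul]
  rw [Finset.sum_comm]

lemma truncSum_neg (a : Word n → ℂ) (k : ℕ) (X : Fin n → K →L[ℂ] K) :
    truncSum (-a) X k = - truncSum a X k := by
  simp [truncSum, Finset.sum_neg_distrib]

lemma holOp_neg (a : Word n → ℂ) (X : Fin n → K →L[ℂ] K) : holOp (-a) X = - holOp a X := by
  simp [holOp, truncSum_neg, tsum_neg]

lemma sqS_neg (a : Word n → ℂ) (k : ℕ) : sqS (-a) k = sqS a k := by simp [sqS]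

variable [CompleteSpace K]

lemma sum_adj_sq (X : Fin n → K →L[ℂ] K) (h : K) :
    ∑ i, ‖adjoint (X i) h‖ ^ 2 ≤ ‖∑ i, X i * adjoint (X i)‖ * ‖h‖ ^ 2 := by
  have h1 : (∑ i, ‖adjoint (X i) h‖ ^ 2 : ℝ)
      = RCLike.re (inner ℂ ((∑ i, X i * adjoint (X i)) h) h) := by
    rw [sum_apply, sum_inner, map_sum]
    refine Finset.sum_congr rfl fun i _ => ?_
    rw [mul_apply_eq_comp, ← adjoint_inner_right, inner_self_eq_norm_sq]
  rw [h1]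
  refine (RCLike.re_le_norm _).trans ((norm_inner_le_norm _ _).trans ?_)
  calc _ ≤ (‖∑ i, X i * adjoint (X i)‖ * ‖h‖) * ‖h‖ := by
        gcongr; exact le_opNorm _ _
    _ = _ := by ring

lemma truncSum_adj_bound (X : Fin n → K →L[ℂ] K) (k : ℕ) : ∀ (a : Word n → ℂ) (h : K),
    ‖adjoint (truncSum a X k) h‖ ≤
      √(sqS a k) * √(‖∑ i, X i * adjoint (X i)‖) ^ k * ‖h‖ := by
  induction k with
  | zero =>
    intro a h
    simp [truncSum_zero, sqS, word_zero, ← star_eq_adjoint, norm_smul]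
  | succ k ih =>
    intro a h
    set ρ := ‖∑ i, X i * adjoint (X i)‖ with hρ
    have e : adjoint (truncSum a X (k+1)) h
        = ∑ i, adjoint (truncSum (shiftC i a) X k) (adjoint (X i) h) := by
      rw [truncSum_succ]
      simp only [← star_eq_adjoint, star_sum, star_mul, sum_apply, mul_apply_eq_comp]
    rw [e]
    calc _ ≤ ∑ i, ‖adjoint (truncSum (shiftC i a) X k) (adjoint (X i) h)‖ := norm_sum_le _ _
      _ ≤ ∑ i, √(sqS (shiftC i a) k) * √ρ ^ k * ‖adjoint (X i) h‖ :=
        Finset.sum_le_sum fun i _ => ih _ _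
      _ = √ρ ^ k * ∑ i, √(sqS (shiftC i a) k) * ‖adjoint (X i) h‖ := by
        rw [Finset.mul_sum]; refine Finset.sum_congr rfl fun i _ => by ring
      _ ≤ √ρ ^ k * (√(∑ i, √(sqS (shiftC i a) k) ^ 2) * √(∑ i, ‖adjoint (X i) h‖ ^ 2)) := by
        gcongr; exact Real.sum_mul_le_sqrt_mul_sqrt _ _ _
      _ ≤ √ρ ^ k * (√(sqS a (k+1)) * √(ρ * ‖h‖ ^ 2)) := by
        gcongr
        · rw [sqS_succ]
          exact Finset.sum_le_sum fun i _ => (Real.sq_sqrt (sqS_nonneg _ _)).le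
        · exact sum_adj_sq X h
      _ = _ := by
        rw [Real.sqrt_mul (norm_nonneg _), Real.sqrt_sq (norm_nonneg _)]; ring

lemma truncSum_bound (X : Fin n → K →L[ℂ] K) (k : ℕ) (a : Word n → ℂ) :
    ‖truncSum a X k‖ ≤ √(sqS a k) * √(‖∑ i, X i * adjoint (X i)‖) ^ k := by
  rw [← (adjoint : (K →L[ℂ] K) ≃ₗᵢ⋆[ℂ] (K →L[ℂ] K)).norm_map]
  exact opNorm_le_bound _ (by positivity) fun h => truncSum_adj_bound X k a h

lemma inBall_smul (z : ℂ) (X : Fin n → K →L[ℂ] K)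
    (h : ‖z‖ ^ 2 * ‖∑ i, X i * adjoint (X i)‖ < 1) : inBall 1 (fun i => z • X i) := by
  have : ∑ i, (z • X i) * adjoint (z • X i) = (z * star z) • ∑ i, X i * adjoint (X i) := by
    rw [Finset.smul_sum]
    refine Finset.sum_congr rfl fun i _ => ?_
    rw [← star_eq_adjoint, star_smul, smul_mul_smul_comm, star_eq_adjoint]
  unfold inBall
  rw [this, norm_smul, norm_mul, norm_star, ← pow_two]
  simpa using h
end

lemma radCond_iff {n : ℕ} (a : Word n → ℂ) :
    radCond 1 a ↔ ∀ t : ℝ, 1 < t → ∀ᶠ k : ℕ in atTop, sqS a k ≤ t ^ (2 * k) := by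
  have key : ∀ k : ℕ, 1 ≤ k → ∀ t : ℝ, 1 < t →
      ((∑ f : Fin k → Fin n, (‖a (word f)‖₊ : ℝ≥0∞) ^ 2) ^ ((1 : ℝ) / (2 * (k : ℝ)))
        ≤ ENNReal.ofReal t ↔ sqS a k ≤ t ^ (2 * k)) := by
    intro k hk t ht
    have e : (∑ f : Fin k → Fin n, (‖a (word f)‖₊ : ℝ≥0∞) ^ 2) = ENNReal.ofReal (sqS a k) := by
      rw [sqS, ENNReal.ofReal_sum_of_nonneg (fun _ _ => by positivity)]
      refine Finset.sum_congr rfl fun f _ => ?_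
      rw [ENNReal.ofReal_pow (norm_nonneg _), ofReal_norm]; rfl
    have hk' : (0:ℝ) < 2 * k := by positivity
    rw [e, one_div, ENNReal.rpow_inv_le_iff hk', ENNReal.ofReal_rpow_of_pos (by linarith),
      ENNReal.ofReal_le_ofReal_iff (by positivity)]
    rw [← Real.rpow_natCast]; push_cast; rfl
  unfold radCond
  rw [show ENNReal.ofReal (1/1) = 1 by simp]
  constructor
  · intro h t ht
    have : (1 : ℝ≥0∞) < ENNReal.ofReal t := by simpa using ht
    filter_upwards [eventually_lt_of_limsup_lt (h.trans_lt this), eventually_ge_atTop 1]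
      with k hk h1
    exact (key k h1 t ht).1 hk.le
  · intro h
    refine le_of_forall_gt_imp_ge_of_dense fun s hs => ?_
    rcases eq_or_ne s ⊤ with rfl | hs'
    · exact le_top
    have ht : 1 < s.toReal := by
      rw [← ENNReal.toReal_one]; exact (ENNReal.toReal_lt_toReal (by simp) hs').2 hs
    refine limsup_le_of_le (by isBoundedDefault) ?_
    filter_upwards [h _ ht, eventually_ge_atTop 1] with k hk h1
    have := (key k h1 _ ht).2 hk
    rwa [ENNReal.ofReal_toReal hs'] at this

lemma radCond_neg {n : ℕ} {a : Word n → ℂ} (h : radCond 1 a) : radCond 1 (-a) := by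
  rw [radCond_iff] at *
  simpa [sqS_neg] using h

section
variable {n : ℕ} {K : Type} [NormedAddCommGroup K] [InnerProductSpace ℂ K] [CompleteSpace K]

lemma exists_R {ρ : ℝ} (h0 : 0 ≤ ρ) (h : ρ < 1) : ∃ t : ℝ, 1 < t ∧ t ^ 2 * ρ < 1 := by
  refine ⟨√(2 / (1 + ρ)), ?_, ?_⟩
  · rw [Real.lt_sqrt (by norm_num), one_pow, one_lt_div (by linarith)]; linarith
  · rw [Real.sq_sqrt (by positivity), div_mul_eq_mul_div, div_lt_one (by linarith)]; linarith

lemma summable_truncSum {a : Word n → ℂ} (ha : radCond 1 a) {X : Fin n → K →L[ℂ] K}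
    (hX : inBall 1 X) : Summable fun k => ‖truncSum a X k‖ := by
  have hX' : ‖∑ i, X i * adjoint (X i)‖ < 1 := by simpa [inBall] using hX
  obtain ⟨t, ht, htr⟩ := exists_R (norm_nonneg _) hX'
  set ρ := ‖∑ i, X i * adjoint (X i)‖ with hρ
  have hq : t * √ρ < 1 := by
    have : (t * √ρ) ^ 2 < 1 ^ 2 := by rw [mul_pow, Real.sq_sqrt (norm_nonneg _)]; simpa using htr
    exact lt_of_pow_lt_pow_left₀ 2 (by norm_num) this
  refine summable_of_isBigO_nat (summable_geometric_of_lt_one (by positivity) hq) ?_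
  refine Asymptotics.IsBigO.of_bound 1 ?_
  filter_upwards [(radCond_iff a).1 ha t ht] with k hk
  rw [norm_norm, one_mul, Real.norm_of_nonneg (by positivity), mul_pow]
  refine (truncSum_bound X k a).trans ?_
  gcongr
  rw [Real.sqrt_le_left (by positivity), ← pow_mul, mul_comm k 2]
  exact hk

lemma holOp_zero_ball {a : Word n → ℂ} (ha0 : a 1 = 0) (ha : radCond 1 a)
    (hb : ∀ X : Fin n → K →L[ℂ] K, inBall 1 X → ‖holOp a X‖ ≤ 1)
    {X : Fin n → K →L[ℂ] K} (hX : inBall 1 X) : ‖holOp a X‖ < 1 := by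
  have hX' : ‖∑ i, X i * adjoint (X i)‖ < 1 := by simpa [inBall] using hX
  obtain ⟨R, hR, hRr⟩ := exists_R (norm_nonneg _) hX'
  have hball : ∀ z : ℂ, ‖z‖ ≤ R → inBall 1 (fun i => z • X i) := fun z hz =>
    inBall_smul z X (lt_of_le_of_lt (by gcongr) hRr)
  have hs := summable_truncSum ha (hball (R : ℂ) (by simp [abs_of_pos (by linarith : 0 < R)]))
  have hd : DifferentiableOn ℂ (fun z : ℂ => ∑' k, truncSum a (fun i => z • X i) k)
      (Metric.ball 0 R) := by
    refine Complex.differentiableOn_tsum_of_summable_norm hs (fun k => ?_) Metric.isOpen_ball ?_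
    · simp only [truncSum_smul]; fun_prop
    · intro k z hz
      have hz' : ‖z‖ < R := by simpa using hz
      simp only [truncSum_smul, norm_smul, norm_pow, Complex.norm_real]
      gcongr
      exact hz'.le.trans (le_abs_self _)
  have h0 : holOp a (fun i => (0:ℂ) • X i) = 0 := by
    simp only [holOp, truncSum_smul]
    rw [tsum_eq_single 0 (fun k hk => by simp [hk])]
    simp [truncSum_zero, ha0]
  have := Complex.dist_le_div_mul_dist_of_mapsTo_ball (R₂ := 1) (z := 1) hd ?_ (by simpa using hR)
  · change dist (holOp a (fun i => (1:ℂ) • X i)) (holOp a (fun i => (0:ℂ) • X i)) ≤ _ at this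
    rw [h0] at this
    simp only [one_smul, dist_zero_right, norm_one, mul_one, one_div] at this
    exact this.trans_lt (inv_lt_one_of_one_lt₀ hR)
  · intro z hz
    change holOp a (fun i => z • X i) ∈ Metric.closedBall (holOp a (fun i => (0:ℂ) • X i)) 1
    rw [h0]
    simpa using hb _ (hball z (by simpa using (Metric.mem_ball.1 hz).le))
end

instance {n : ℕ} : DecidableEq (Word n) := inferInstanceAs (DecidableEq (List (Fin n)))

/-- The full Fock space. -/
abbrev Fock (n : ℕ) : Type := lp (fun _ : Word n => ℂ) 2

lemma fock_hasSum {n : ℕ} (v : Fock n) : HasSum (fun w => ‖v w‖ ^ 2) (‖v‖ ^ 2) := by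
  have := lp.hasSum_norm (p := 2) (by simp) v
  simpa using this

lemma fock_comp {n : ℕ} {β : Type} (φ : β → Word n) (hφ : Function.Injective φ) (v : Fock n) :
    Summable (fun b => ‖v (φ b)‖ ^ 2) ∧ ∑' b, ‖v (φ b)‖ ^ 2 ≤ ‖v‖ ^ 2 := by
  have h := (fock_hasSum v).summable.comp_injective hφ
  refine ⟨h, ?_⟩
  rw [← (fock_hasSum v).tsum_eq]
  exact h.tsum_le_tsum_of_inj φ hφ (fun _ _ => by positivity) (fun _ => le_rfl)
    (fock_hasSum v).summable

lemma mulLeft_inj {n : ℕ} (i : Fin n) :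
    Function.Injective (fun w : Word n => FreeMonoid.of i * w) := fun _ _ h => mul_left_cancel h

/-- Backward shift on the Fock space. -/
def bShift {n : ℕ} (i : Fin n) : Fock n →L[ℂ] Fock n :=
  LinearMap.mkContinuous
    { toFun := fun v => ⟨fun w => v (FreeMonoid.of i * w), by
        refine memℓp_gen ?_
        simpa using (fock_comp _ (mulLeft_inj i) v).1⟩
      map_add' := fun _ _ => rfl
      map_smul' := fun _ _ => rfl } 1 (fun v => by
        rw [one_mul]
        refine (pow_le_pow_iff_left₀ (norm_nonneg _) (norm_nonneg _) two_ne_zero).1 ?_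
        rw [← (fock_hasSum _).tsum_eq]
        exact (fock_comp _ (mulLeft_inj i) v).2)

lemma bShift_apply {n : ℕ} (i : Fin n) (v : Fock n) (w : Word n) :
    bShift i v w = v (FreeMonoid.of i * w) := rfl

/-- Left creation operators. -/
def crea {n : ℕ} (i : Fin n) : Fock n →L[ℂ] Fock n := adjoint (bShift i)

lemma crea_ball {n : ℕ} : ‖∑ i, crea (n := n) i * adjoint (crea i)‖ ≤ 1 := by
  have hpair : Function.Injective (fun p : Fin n × Word n => FreeMonoid.of p.1 * p.2) := by
    rintro ⟨i, w⟩ ⟨j, u⟩ h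
    have h' : i :: FreeMonoid.toList w = j :: FreeMonoid.toList u := congrArg FreeMonoid.toList h
    simp only [List.cons.injEq, EmbeddingLike.apply_eq_iff_eq] at h'
    exact Prod.ext h'.1 h'.2
  have hsq : ∀ v : Fock n, ∑ i, ‖bShift i v‖ ^ 2 ≤ ‖v‖ ^ 2 := by
    intro v
    obtain ⟨h1, h2⟩ := fock_comp _ hpair v
    refine le_trans (le_of_eq ?_) h2
    rw [h1.tsum_prod, tsum_fintype]
    refine Finset.sum_congr rfl fun i _ => ?_
    rw [← (fock_hasSum _).tsum_eq]
    rfl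
  set T := ∑ i, crea (n := n) i * adjoint (crea i) with hT
  have hin : ∀ u v : Fock n, ‖inner ℂ (T u) v‖ ≤ ‖u‖ * ‖v‖ := by
    intro u v
    have e : inner ℂ (T u) v = ∑ i, inner ℂ (bShift i u) (bShift i v) := by
      rw [hT, sum_apply, sum_inner]
      refine Finset.sum_congr rfl fun i _ => ?_
      rw [mul_apply_eq_comp, crea, adjoint_adjoint, adjoint_inner_left]
    rw [e]
    calc _ ≤ ∑ i, ‖bShift i u‖ * ‖bShift i v‖ :=
          (norm_sum_le _ _).trans (Finset.sum_le_sum fun i _ => norm_inner_le_norm _ _)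
      _ ≤ √(∑ i, ‖bShift i u‖ ^ 2) * √(∑ i, ‖bShift i v‖ ^ 2) :=
          Real.sum_mul_le_sqrt_mul_sqrt _ _ _
      _ ≤ √(‖u‖ ^ 2) * √(‖v‖ ^ 2) := by
          gcongr
          · exact hsq u
          · exact hsq v
      _ = _ := by rw [Real.sqrt_sq (norm_nonneg _), Real.sqrt_sq (norm_nonneg _)]
  refine opNorm_le_bound _ zero_le_one fun u => ?_
  rw [one_mul]
  have h1 := hin u (T u)
  rw [inner_self_eq_norm_sq_to_K, norm_pow, RCLike.norm_ofReal, abs_norm, pow_two] at h1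
  rcases (norm_nonneg (T u)).eq_or_lt with h | h
  · rw [← h]; positivity
  · exact le_of_mul_le_mul_right h1 h

lemma crea_inBall {n : ℕ} {r : ℝ} (h0 : 0 ≤ r) (h1 : r < 1) :
    inBall 1 (fun i => (r : ℂ) • crea (n := n) i) := by
  apply inBall_smul
  rw [Complex.norm_real, Real.norm_of_nonneg h0]
  have := crea_ball (n := n)
  calc _ ≤ r ^ 2 * 1 := by gcongr
    _ < 1 := by nlinarith

/-- Vacuum vector and other basis vectors. -/
def fe {n : ℕ} (w : Word n) : Fock n := lp.single 2 w 1

lemma fe_apply {n : ℕ} (w u : Word n) : fe w u = if u = w then 1 else 0 := by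
  rw [fe, lp.single_apply, Pi.single_apply]

lemma apply_eq_inner {n : ℕ} (v : Fock n) (w : Word n) : v w = inner ℂ (fe w) v := by
  rw [fe, lp.inner_single_left]; simp

lemma crea_nil {n : ℕ} (i : Fin n) (v : Fock n) : crea i v 1 = 0 := by
  rw [apply_eq_inner, crea, adjoint_inner_right]
  have : bShift i (fe (1 : Word n)) = 0 := by
    ext w
    rw [bShift_apply, fe_apply, if_neg]
    · rfl
    · intro h
      have := congrArg FreeMonoid.length h
      simp at this
  rw [this, inner_zero_left]

lemma crea_cons {n : ℕ} (i j : Fin n) (v : Fock n) (w : Word n) :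
    crea i v (FreeMonoid.of j * w) = if i = j then v w else 0 := by
  rw [apply_eq_inner, crea, adjoint_inner_right]
  have : bShift i (fe (FreeMonoid.of j * w)) = if i = j then fe w else 0 := by
    ext u
    rw [bShift_apply, fe_apply]
    have e : (FreeMonoid.of i * u = FreeMonoid.of j * w) ↔ (i = j ∧ u = w) := by
      constructor
      · intro h
        have h' : i :: FreeMonoid.toList u = j :: FreeMonoid.toList w :=
          congrArg FreeMonoid.toList h
        simpa only [List.cons.injEq, EmbeddingLike.apply_eq_iff_eq] using h'
      · rintro ⟨rfl, rfl⟩; rfl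
    by_cases hij : i = j
    · subst hij; simp only [e, true_and, if_true, fe_apply]
    · simp only [e, hij, false_and, if_false]; rfl
  rw [this]
  split_ifs
  · rw [← apply_eq_inner]
  · rw [inner_zero_left]

lemma fock_sum_apply {n : ℕ} {ι : Type*} (s : Finset ι) (v : ι → Fock n) (w : Word n) :
    (∑ i ∈ s, v i) w = ∑ i ∈ s, v i w := by
  simp only [apply_eq_inner, inner_sum]

lemma truncSum_crea {n : ℕ} (v : Fock n) (k : ℕ) : ∀ (a : Word n → ℂ) (w : Word n),
    truncSum a crea k v w = if k ≤ wordLen w then convK k a v w else 0 := by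
  induction k with
  | zero => intro a w; rw [truncSum_zero]; simp [convK]
  | succ k ih =>
    intro a w
    rw [truncSum_succ, sum_apply, fock_sum_apply]
    induction w using FreeMonoid.casesOn with
    | one => simp [crea_nil, wordLen]
    | of_mul j w =>
      simp only [mul_apply_eq_comp, crea_cons]
      rw [Finset.sum_ite_eq' Finset.univ j, if_pos (Finset.mem_univ _), ih]
      have : wordLen (FreeMonoid.of j * w) = wordLen w + 1 := by simp [wordLen]
      simp only [this, Nat.add_le_add_iff_right]
      rfl

lemma holOp_crea {n : ℕ} {a : Word n → ℂ} (ha : radCond 1 a) {r : ℝ} (h0 : 0 ≤ r) (h1 : r < 1)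
    (v : Fock n) (w : Word n) :
    holOp a (fun i => (r : ℂ) • crea i) v w =
      ∑ k ∈ Finset.range (wordLen w + 1), (r : ℂ) ^ k * convK k a v w := by
  have hs := (summable_truncSum ha (crea_inBall (n := n) h0 h1)).of_norm.hasSum
  have h2 : HasSum (fun k => (r : ℂ) ^ k * (if k ≤ wordLen w then convK k a v w else 0))
      (holOp a (fun i => (r : ℂ) • crea i) v w) := by
    rw [apply_eq_inner]
    have := (innerSL ℂ (fe w)).hasSum ((ContinuousLinearMap.apply ℂ (Fock n) v).hasSum hs)
    refine (congrArg (fun F => HasSum F _) (funext fun k => ?_)).mp this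
    simp only [truncSum_smul, ContinuousLinearMap.apply_apply, innerSL_apply_apply,
      smul_apply, inner_smul_right, ← apply_eq_inner, truncSum_crea]
  refine h2.unique ?_
  have e : ∑ k ∈ Finset.range (wordLen w + 1), (r : ℂ) ^ k * convK k a v w
      = ∑ k ∈ Finset.range (wordLen w + 1),
        (r : ℂ) ^ k * (if k ≤ wordLen w then convK k a v w else 0) := by
    refine Finset.sum_congr rfl fun k hk => ?_
    rw [if_pos (by simpa [Nat.lt_succ_iff] using hk)]
  rw [e]
  refine hasSum_sum_of_ne_finset_zero fun k hk => ?_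
  rw [if_neg (by simpa [Nat.lt_succ_iff] using hk), mul_zero]

lemma convK_len {n : ℕ} (a c : Word n → ℂ) (w : Word n) : convK (wordLen w) a c w = a w * c 1 := by
  simp [convK, wordLen]

lemma holOp_inj {n : ℕ} {a b : Word n → ℂ} (ha : radCond 1 a) (hb : radCond 1 b)
    (h : ∀ (K : Type) [NormedAddCommGroup K] [InnerProductSpace ℂ K] [CompleteSpace K]
        (X : Fin n → K →L[ℂ] K), inBall 1 X → holOp a X = holOp b X) : a = b := by
  have key : ∀ {a : Word n → ℂ}, radCond 1 a → ∀ w,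
      holOp a (fun i => ((1/2 : ℝ) : ℂ) • crea i) (fe 1) w
        = ((1/2 : ℝ) : ℂ) ^ wordLen w * a w := by
    intro a ha w
    rw [holOp_crea ha (by norm_num) (by norm_num), Finset.sum_range_succ, convK_len,
      Finset.sum_eq_zero, fe_apply]
    · simp
    · intro k hk
      have hk' : k < wordLen w := by simpa using hk
      rw [convK, fe_apply, if_neg, mul_zero, mul_zero]
      intro h
      have := congrArg (fun u : Word n => (FreeMonoid.toList u).length) h
      simp [wordLen] at this hk'
      omega
  funext w
  have e := key ha w
  rw [h _ _ (crea_inBall (by norm_num) (by norm_num)), key hb w] at e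
  exact (mul_left_cancel₀ (pow_ne_zero _ (by norm_num)) e).symm

/-- Coefficients of `(1 - a)⁻¹`, on lists. -/
def geomL {n : ℕ} (a : List (Fin n) → ℂ) : List (Fin n) → ℂ
  | [] => 1
  | i :: l => ∑ k : Fin (l.length + 1), a (i :: l.take k) * geomL a (l.drop k)
termination_by l => l.length
decreasing_by simp

/-- Coefficients of `(1 - a)⁻¹`. -/
def geomC {n : ℕ} (a : Word n → ℂ) : Word n → ℂ :=
  fun w => geomL (fun l => a (FreeMonoid.ofList l)) (FreeMonoid.toList w)

lemma geomC_one {n : ℕ} (a : Word n → ℂ) : geomC a 1 = 1 := by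
  simp [geomC, geomL]

lemma rec_split {n : ℕ} {a : Word n → ℂ} (ha0 : a 1 = 0) (z : ℂ) (v : Word n → ℂ) (i : Fin n)
    (w : Word n) :
    ∑ k ∈ Finset.range (wordLen (FreeMonoid.of i * w) + 1),
        z ^ k * convK k a v (FreeMonoid.of i * w)
      = ∑ k ∈ Finset.range (wordLen w + 1), z ^ (k+1) * (a (FreeMonoid.of i *
        FreeMonoid.ofList ((FreeMonoid.toList w).take k)) *
          v (FreeMonoid.ofList ((FreeMonoid.toList w).drop k))) := by
  have : wordLen (FreeMonoid.of i * w) = wordLen w + 1 := by simp [wordLen]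
  rw [this, Finset.sum_range_succ']
  have h0 : convK 0 a v (FreeMonoid.of i * w) = 0 := by
    simp [convK, ha0]
  rw [h0, mul_zero, add_zero]
  rfl

lemma geomC_cons {n : ℕ} (a : Word n → ℂ) (i : Fin n) (w : Word n) :
    geomC a (FreeMonoid.of i * w) = ∑ k ∈ Finset.range (wordLen w + 1), (a (FreeMonoid.of i *
        FreeMonoid.ofList ((FreeMonoid.toList w).take k)) *
          geomC a (FreeMonoid.ofList ((FreeMonoid.toList w).drop k))) := by
  rw [Finset.sum_range]
  change geomL _ (i :: FreeMonoid.toList w) = _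
  rw [geomL]
  rfl

lemma geomC_rec {n : ℕ} {a : Word n → ℂ} (ha0 : a 1 = 0) (w : Word n) :
    geomC a w = (if w = 1 then 1 else 0) +
      ∑ k ∈ Finset.range (wordLen w + 1), convK k a (geomC a) w := by
  induction w using FreeMonoid.casesOn with
  | one => simp [geomC_one, wordLen, convK, ha0]
  | of_mul j w =>
    have h := rec_split ha0 1 (geomC a) j w
    simp only [one_pow, one_mul] at h
    rw [h, geomC_cons, if_neg, zero_add]
    intro h
    have := congrArg FreeMonoid.length h
    simp at this

lemma geomC_unique {n : ℕ} {a : Word n → ℂ} (ha0 : a 1 = 0) (z : ℂ) (v : Word n → ℂ)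
    (hv : ∀ w, v w = (if w = 1 then 1 else 0) +
      ∑ k ∈ Finset.range (wordLen w + 1), z ^ k * convK k a v w) (m : ℕ) :
    ∀ w, wordLen w ≤ m → v w = z ^ wordLen w * geomC a w := by
  induction m with
  | zero =>
    intro w hw
    have : w = 1 := by
      have : FreeMonoid.toList w = [] := by simpa [wordLen] using hw
      exact this
    subst this
    rw [hv]; simp [wordLen, convK, ha0, geomC_one]
  | succ m ih =>
    intro w hw
    induction w using FreeMonoid.casesOn with
    | one => rw [hv]; simp [wordLen, convK, ha0, geomC_one]
    | of_mul j w =>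
      have hl : wordLen (FreeMonoid.of j * w) = wordLen w + 1 := by simp [wordLen]
      rw [hv, rec_split ha0, geomC_cons, if_neg, zero_add, Finset.mul_sum]
      · refine Finset.sum_congr rfl fun k hk => ?_
        have hk' : k ≤ wordLen w := by simpa [Nat.lt_succ_iff] using hk
        have hd : wordLen (FreeMonoid.ofList ((FreeMonoid.toList w).drop k)) = wordLen w - k := by
          simp [wordLen]
        rw [ih _ (by omega), hd, hl, show wordLen w + 1 = (k+1) + (wordLen w - k) by omega,
          pow_add z (k+1)]
        ring
      · intro h
        have := congrArg FreeMonoid.length h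
        simp at this

lemma geomC_radCond {n : ℕ} {a : Word n → ℂ} (ha0 : a 1 = 0) (ha : radCond 1 a)
    (hu : ∀ (X : Fin n → Fock n →L[ℂ] Fock n), inBall 1 X → IsUnit (1 - holOp a X)) :
    radCond 1 (geomC a) := by
  have hC : ∀ r : ℝ, 0 ≤ r → r < 1 → ∃ C : ℝ, ∀ k, r ^ (2 * k) * sqS (geomC a) k ≤ C := by
    intro r h0 h1
    have hun := hu _ (crea_inBall h0 h1)
    set F := holOp a (fun i => (r : ℂ) • crea (n := n) i) with hF
    set v := Ring.inverse (1 - F) (fe 1) with hv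
    have hv1 : v = fe 1 + F v := by
      have : (1 - F) v = fe 1 := by
        rw [hv, ← mul_apply_eq_comp, Ring.mul_inverse_cancel _ hun]; rfl
      rw [← this]; simp
    have hvr := geomC_unique ha0 (r : ℂ) v (fun w => by
      rw [← holOp_crea ha h0 h1, ← fe_apply]
      conv_lhs => rw [hv1]
      rfl)
    refine ⟨‖v‖ ^ 2, fun k => ?_⟩
    have hinj : Function.Injective (fun f : Fin k → Fin n => word f) := by
      intro f g h
      exact List.ofFn_injective h
    have := (fock_comp _ hinj v).2
    rw [tsum_fintype] at this
    refine le_trans (le_of_eq ?_) this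
    rw [sqS, Finset.mul_sum]
    refine Finset.sum_congr rfl fun f _ => ?_
    have hl : wordLen (word f) = k := by simp [word, wordLen]
    rw [hvr _ _ le_rfl, hl, norm_mul, mul_pow, norm_pow, Complex.norm_real,
      Real.norm_of_nonneg h0, ← pow_mul, mul_comm k 2]
  rw [radCond_iff]
  intro t ht
  obtain ⟨s, hs1, hst⟩ := exists_between ht
  obtain ⟨C, hC⟩ := hC s⁻¹ (by positivity) (inv_lt_one_of_one_lt₀ hs1)
  have hq : 1 < (t / s) ^ 2 := by
    have : 1 < t / s := by rw [one_lt_div (by linarith)]; exact hst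
    nlinarith
  filter_upwards [(tendsto_pow_atTop_atTop_of_one_lt hq).eventually_ge_atTop C] with k hk
  have h := (hC k).trans hk
  have hs : 0 < s ^ (2 * k) := by positivity
  rw [← pow_mul, div_pow, inv_pow, inv_mul_eq_div] at h
  exact (div_le_div_iff_of_pos_right hs).1 h

lemma holOp_geomC {n : ℕ} {a : Word n → ℂ} (ha0 : a 1 = 0) (ha : radCond 1 a)
    (hg : radCond 1 (geomC a))
    {K : Type} [NormedAddCommGroup K] [InnerProductSpace ℂ K] [CompleteSpace K]
    {X : Fin n → K →L[ℂ] K} (hX : inBall 1 X) :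
    holOp (geomC a) X = 1 + holOp a X * holOp (geomC a) X := by
  have hs1 := summable_truncSum ha hX
  have hs2 := summable_truncSum hg hX
  have h := tsum_mul_tsum_eq_tsum_sum_range_of_summable_norm hs1 hs2
  have hs3 := (summable_norm_sum_mul_range_of_summable_norm hs1 hs2).of_norm
  have hδ : HasSum (fun m : ℕ => if m = 0 then (1 : K →L[ℂ] K) else 0) 1 := hasSum_ite_eq 0 1
  change holOp a X * holOp (geomC a) X = _ at h
  rw [h]
  nth_rewrite 1 [← hδ.tsum_eq]
  rw [← hδ.summable.tsum_add hs3, holOp]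
  refine tsum_congr fun m => ?_
  have e : truncSum (geomC a) X m = truncSum (fun w => ∑ k ∈ Finset.range (m + 2),
      (if h : k = 0 then (fun w => if w = 1 then 1 else 0) else convK (k-1) a (geomC a)) w) X m := by
    refine truncSum_congr (fun w hw => ?_) X
    rw [Finset.sum_range_succ', geomC_rec ha0, hw]
    simp [add_comm]
  rw [e, truncSum_sum, Finset.sum_range_succ', add_comm]
  congr 1
  · simp only [dite_true]
    cases m with
    | zero => simp [truncSum_zero]
    | succ m =>
      rw [truncSum_congr (b := fun _ => 0)]
      · simp [truncSum]
      · intro w hw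
        rw [if_neg]
        rintro rfl
        simp [wordLen] at hw
  · refine Finset.sum_congr rfl fun k hk => ?_
    have hk' : k ≤ m := by simpa [Nat.lt_succ_iff] using hk
    obtain ⟨j, rfl⟩ := Nat.exists_eq_add_of_le hk'
    simp [truncSum_convK]

lemma cayley_exists {n : ℕ} {a : Word n → ℂ} (ha0 : a 1 = 0) (ha : radCond 1 a)
    (hu : ∀ (K : Type) [NormedAddCommGroup K] [InnerProductSpace ℂ K] [CompleteSpace K]
        (X : Fin n → K →L[ℂ] K), inBall 1 X → IsUnit (1 - holOp a X)) :
    ∃ d : Word n → ℂ, d 1 = 0 ∧ radCond 1 d ∧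
      ∀ (K : Type) [NormedAddCommGroup K] [InnerProductSpace ℂ K] [CompleteSpace K]
        (X : Fin n → K →L[ℂ] K), inBall 1 X →
          holOp d X = holOp a X * Ring.inverse (1 - holOp a X) := by
  have hg := geomC_radCond ha0 ha (hu (Fock n))
  refine ⟨Function.update (geomC a) 1 0, by simp, ?_, ?_⟩
  · rw [radCond_iff] at *
    intro t ht
    filter_upwards [hg t ht] with k hk
    refine le_trans (Finset.sum_le_sum fun f _ => ?_) hk
    by_cases h : word f = 1
    · rw [h]; simp
    · rw [Function.update_of_ne h]
  · intro K _ _ _ X hX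
    have h1 := holOp_geomC ha0 ha hg hX
    have hun := hu K X hX
    have h2 : holOp (geomC a) X = Ring.inverse (1 - holOp a X) := by
      have : (1 - holOp a X) * holOp (geomC a) X = 1 := by
        rw [sub_mul, one_mul]; exact sub_eq_of_eq_add h1
      calc _ = Ring.inverse (1 - holOp a X) * ((1 - holOp a X) * holOp (geomC a) X) := by
            rw [← mul_assoc, Ring.inverse_mul_cancel _ hun, one_mul]
        _ = _ := by rw [this, mul_one]
    rw [← h2, ← sub_eq_of_eq_add' h1]
    have hs := (summable_truncSum hg hX).of_norm
    rw [holOp, holOp, hs.tsum_eq_zero_add, truncSum_zero, geomC_one, one_smul,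
      add_sub_cancel_left]
    have hz : ∀ m, truncSum (Function.update (geomC a) 1 0) X (m+1)
        = truncSum (geomC a) X (m+1) := fun m => truncSum_congr (fun w hw => by
          rw [Function.update_of_ne]; rintro rfl; simp [wordLen] at hw) X
    have h0 : truncSum (Function.update (geomC a) 1 0) X 0 = 0 := by
      simp [truncSum_zero]
    have hs' : Summable (fun m => truncSum (Function.update (geomC a) 1 0) X m) := by
      rw [← summable_nat_add_iff 1]
      simp only [hz]
      exact (summable_nat_add_iff 1).2 hs
    rw [hs'.tsum_eq_zero_add, h0, zero_add]
    exact tsum_congr hz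

section
variable {K : Type} [NormedAddCommGroup K] [InnerProductSpace ℂ K] [CompleteSpace K]

lemma re_identity (G : K →L[ℂ] K) (x : K) :
    RCLike.re (inner ℂ ((adjoint G + 1 + G) x) x) = ‖x + G x‖ ^ 2 - ‖G x‖ ^ 2 := by
  rw [norm_add_sq (𝕜 := ℂ)]
  simp only [add_apply, one_apply_eq_self, inner_add_left, map_add, adjoint_inner_left,
    inner_self_eq_norm_sq]
  rw [inner_re_symm (𝕜 := ℂ) (G x) x]
  ring

lemma isPos_iff (G : K →L[ℂ] K) :
    (adjoint G + 1 + G).IsPositive ↔ ∀ x, ‖G x‖ ≤ ‖x + G x‖ := by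
  have hsa : IsSelfAdjoint (adjoint G + 1 + G) := by
    rw [IsSelfAdjoint, ← star_eq_adjoint]; simp; abel
  rw [isPositive_def']
  simp only [hsa, true_and, reApplyInnerSelf_apply, re_identity, sub_nonneg]
  exact forall_congr' fun x => pow_le_pow_iff_left₀ (norm_nonneg _) (norm_nonneg _) (by norm_num)

lemma isUnit_of_pos {G : K →L[ℂ] K} (h : (adjoint G + 1 + G).IsPositive) : IsUnit (1 + G) := by
  refine isUnit_of_forall_le_norm_inner_map _ (c := 1/2) (by norm_num) fun x => ?_
  refine le_trans ?_ (RCLike.re_le_norm _)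
  have h1 := (isPositive_def'.1 h).2 x
  rw [reApplyInnerSelf_apply] at h1
  simp only [add_apply, one_apply_eq_self, inner_add_left, map_add, adjoint_inner_left,
    inner_self_eq_norm_sq] at h1 ⊢
  rw [inner_re_symm (𝕜 := ℂ) x (G x)] at h1
  push_cast
  linarith

end

lemma ring_aux {R : Type*} [Ring R] {f g : R} (hu : IsUnit (1 - f))
    (h : g = f * Ring.inverse (1 - f)) : (1 + g) * (1 - f) = 1 ∧ (1 - f) * (1 + g) = 1 := by
  have h1 : 1 + g = Ring.inverse (1 - f) := by
    have := Ring.mul_inverse_cancel _ hu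
    rw [h]
    nth_rewrite 1 [← this]
    rw [← add_mul]; simp
  rw [h1]
  exact ⟨Ring.inverse_mul_cancel _ hu, Ring.mul_inverse_cancel _ hu⟩

lemma contr_isUnit {n : ℕ} {a : Word n → ℂ} (ha : a ∈ contrHol n)
    (K : Type) [NormedAddCommGroup K] [InnerProductSpace ℂ K] [CompleteSpace K]
    (X : Fin n → K →L[ℂ] K) (hX : inBall 1 X) : IsUnit (1 - holOp a X) :=
  isUnit_one_sub_of_norm_lt_one (holOp_zero_ball ha.1 ha.2.1 (ha.2.2 K) hX)

/-- The noncommutative Cayley transform `f ↦ f (I − f)⁻¹` is a bijection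
between contractive free holomorphic functions vanishing at `0` and free holomorphic
functions `g` with `g(0) = 0` and `g(X)* + I + g(X) ≥ 0` on the unit ball. -/
theorem stmt_12 (n : ℕ) (hn : 1 ≤ n) :
    (∀ a ∈ contrHol n,
      ∀ (K : Type) [NormedAddCommGroup K] [InnerProductSpace ℂ K] [CompleteSpace K]
        (X : Fin n → K →L[ℂ] K), inBall 1 X → IsUnit (1 - holOp a X)) ∧
    (∀ a ∈ contrHol n, ∃! c : Word n → ℂ, c ∈ posReHol n ∧
      ∀ (K : Type) [NormedAddCommGroup K] [InnerProductSpace ℂ K] [CompleteSpace K]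
        (X : Fin n → K →L[ℂ] K), inBall 1 X →
          holOp c X = holOp a X * Ring.inverse (1 - holOp a X)) ∧
    (∀ c ∈ posReHol n, ∃ a ∈ contrHol n,
      ∀ (K : Type) [NormedAddCommGroup K] [InnerProductSpace ℂ K] [CompleteSpace K]
        (X : Fin n → K →L[ℂ] K), inBall 1 X →
          holOp c X = holOp a X * Ring.inverse (1 - holOp a X)) ∧
    (∀ a ∈ contrHol n, ∀ a' ∈ contrHol n, ∀ c ∈ posReHol n,
      (∀ (K : Type) [NormedAddCommGroup K] [InnerProductSpace ℂ K] [CompleteSpace K]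
        (X : Fin n → K →L[ℂ] K), inBall 1 X →
          holOp c X = holOp a X * Ring.inverse (1 - holOp a X)) →
      (∀ (K : Type) [NormedAddCommGroup K] [InnerProductSpace ℂ K] [CompleteSpace K]
        (X : Fin n → K →L[ℂ] K), inBall 1 X →
          holOp c X = holOp a' X * Ring.inverse (1 - holOp a' X)) →
      a = a') := by
  refine ⟨fun a ha K _ _ _ X hX => contr_isUnit ha K X hX, ?_, ?_, ?_⟩
  · intro a ha
    obtain ⟨c, hc0, hc, hcf⟩ := cayley_exists ha.1 ha.2.1 (contr_isUnit ha)
    refine ⟨c, ⟨⟨hc0, hc, ?_⟩, hcf⟩, ?_⟩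
    · intro K _ _ _ X hX
      rw [isPos_iff]
      intro x
      obtain ⟨h1, h2⟩ := ring_aux (contr_isUnit ha K X hX) (hcf K X hX)
      set f := holOp a X
      set g := holOp c X
      have hg : f * (1 + g) = g := by
        rw [sub_mul, one_mul] at h2
        rw [← sub_sub_cancel (1 + g) (f * (1 + g)), h2]; abel
      have hx : g x = f (x + g x) := by
        conv_lhs => rw [← hg]
        rfl
      rw [hx, ← hx]
      calc ‖g x‖ = ‖f (x + g x)‖ := by rw [← hx]
        _ ≤ 1 * ‖x + g x‖ := (le_opNorm _ _).trans (by gcongr; exact ha.2.2 K X hX)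
        _ = _ := one_mul _
    · rintro c' ⟨hc', hcf'⟩
      refine holOp_inj hc'.2.1 hc fun K _ _ _ X hX => ?_
      rw [hcf K X hX, hcf' K X hX]
  · intro c hc
    have hu : ∀ (K : Type) [NormedAddCommGroup K] [InnerProductSpace ℂ K] [CompleteSpace K]
        (X : Fin n → K →L[ℂ] K), inBall 1 X → IsUnit (1 - holOp (-c) X) := by
      intro K _ _ _ X hX
      rw [holOp_neg, sub_neg_eq_add]
      exact isUnit_of_pos (hc.2.2 K X hX)
    obtain ⟨d, hd0, hd, hdf⟩ := cayley_exists (by simp [hc.1]) (radCond_neg hc.2.1) hu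
    have hf : ∀ (K : Type) [NormedAddCommGroup K] [InnerProductSpace ℂ K] [CompleteSpace K]
        (X : Fin n → K →L[ℂ] K), inBall 1 X →
          (1 - holOp (-d) X) * (1 + holOp c X) = 1 ∧ (1 + holOp c X) * (1 - holOp (-d) X) = 1 := by
      intro K _ _ _ X hX
      have := ring_aux (hu K X hX) (hdf K X hX)
      simpa only [holOp_neg, sub_neg_eq_add] using this
    refine ⟨-d, ⟨by simp [hd0], radCond_neg hd, ?_⟩, ?_⟩
    · intro K _ _ _ X hX
      obtain ⟨h1, h2⟩ := hf K X hX
      have hp := (isPos_iff _).1 (hc.2.2 K X hX)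
      set f := holOp (-d) X
      set g := holOp c X
      refine opNorm_le_bound _ zero_le_one fun y => ?_
      have e1 : y = (1 - f) y + g ((1 - f) y) := by
        have := congrArg (fun T : K →L[ℂ] K => T y) h2
        exact this.symm
      have e2 : f y = g ((1 - f) y) := by
        have : f = g * (1 - f) := by
          rw [add_mul, one_mul] at h2
          rw [eq_sub_of_add_eq' h2]; abel
        conv_lhs => rw [this]
        rfl
      have := hp ((1 - f) y)
      rw [← e1, ← e2] at this
      simpa using this
    · intro K _ _ _ X hX
      obtain ⟨h1, h2⟩ := hf K X hX
      set f := holOp (-d) X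
      set g := holOp c X
      have hi : Ring.inverse (1 - f) = 1 + g :=
        Ring.inverse_unit (⟨1 - f, 1 + g, h1, h2⟩ : (K →L[ℂ] K)ˣ)
      rw [hi]
      rw [sub_mul, one_mul] at h1
      rw [← sub_sub_cancel (1 + g) (f * (1 + g)), h1]; abel
  · intro a ha a' ha' c hc h h'
    refine holOp_inj ha.2.1 ha'.2.1 fun K _ _ _ X hX => ?_
    obtain ⟨h1, h2⟩ := ring_aux (contr_isUnit ha K X hX) (h K X hX)
    obtain ⟨h3, h4⟩ := ring_aux (contr_isUnit ha' K X hX) (h' K X hX)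
    have : (1 - holOp a X) = 1 - holOp a' X := left_inv_eq_right_inv h2 h3
    simpa using this


end
end

section
/- Fix m ∈ ℕ and let N^(m) := { Σ_{1 ≤ |α| ≤ m} c_α S_α^(m) : c_α ∈ ℂ } ⊆ B(P^(m)). Then every X ∈ N^(m) with ‖X‖ ≤ 1 satisfies that I − X is invertible, the truncated Cayley transform X ↦ X(I − X)⁻¹ maps { X ∈ N^(m) : ‖X‖ ≤ 1 } bijectively onto { Y ∈ N^(m) : Y* + I + Y ≥ 0 }, and its inverse is Y ↦ Y(I + Y)⁻¹ (with I + Y invertible for every Y ∈ N^(m)). -/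
open scoped ENNReal ComplexOrder
open Filter ContinuousLinearMap

noncomputable section

/-- The set `N^{(m)} = { Σ_{1 ≤ |α| ≤ m} c_α S_α^{(m)} }`. -/
def truncSpace {n : ℕ} {F : Type} [NormedAddCommGroup F] [InnerProductSpace ℂ F]
    (m : ℕ) (Sm : Fin n → F →L[ℂ] F) : Set (F →L[ℂ] F) :=
  {Y | ∃ c : Word n → ℂ, Y = ∑ k ∈ Finset.Icc 1 m, truncSum c Sm k}

/-- Span of the word products of length at least `k`. -/
def tailSpan {n : ℕ} {F : Type} [NormedAddCommGroup F] [InnerProductSpace ℂ F]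
    (Sm : Fin n → F →L[ℂ] F) (k : ℕ) : Submodule ℂ (F →L[ℂ] F) :=
  Submodule.span ℂ {T | ∃ α : Word n, k ≤ wordLen α ∧ T = wordProd Sm α}

theorem wordProd_mul {n : ℕ} {F : Type} [NormedAddCommGroup F] [InnerProductSpace ℂ F]
    (Sm : Fin n → F →L[ℂ] F) (α β : Word n) :
    wordProd Sm (α * β) = wordProd Sm α * wordProd Sm β := by
  simp [wordProd]

theorem wordLen_mul {n : ℕ} (α β : Word n) :
    wordLen (α * β) = wordLen α + wordLen β := by
  simp [wordLen]

theorem wordLen_word {n k : ℕ} (f : Fin k → Fin n) : wordLen (word f) = k := by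
  simp [wordLen, word]

theorem word_inj {n k : ℕ} {f g : Fin k → Fin n} (h : word f = word g) : f = g := by
  apply List.ofFn_injective
  exact FreeMonoid.ofList.injective h

theorem exists_word {n : ℕ} (α : Word n) : ∃ f : Fin (wordLen α) → Fin n, word f = α := by
  refine ⟨fun i => (FreeMonoid.toList α).get i, ?_⟩
  have := List.ofFn_get (FreeMonoid.toList α)
  unfold word
  exact (congrArg FreeMonoid.ofList this).trans (by simp)

theorem tailSpan_mul {n : ℕ} {F : Type} [NormedAddCommGroup F] [InnerProductSpace ℂ F]
    (Sm : Fin n → F →L[ℂ] F) {j k : ℕ} {X Y : F →L[ℂ] F}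
    (hX : X ∈ tailSpan Sm j) (hY : Y ∈ tailSpan Sm k) : X * Y ∈ tailSpan Sm (j + k) := by
  have h := Submodule.mul_mem_mul hX hY
  unfold tailSpan at h
  rw [Submodule.span_mul_span] at h
  refine Submodule.span_mono ?_ h
  rintro _ ⟨_, ⟨α, hα, rfl⟩, _, ⟨β, hβ, rfl⟩, rfl⟩
  exact ⟨α * β, by rw [wordLen_mul]; omega, (wordProd_mul _ _ _).symm⟩

theorem tailSpan_anti {n : ℕ} {F : Type} [NormedAddCommGroup F] [InnerProductSpace ℂ F]
    (Sm : Fin n → F →L[ℂ] F) {j k : ℕ} (h : j ≤ k) : tailSpan Sm k ≤ tailSpan Sm j := by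
  refine Submodule.span_mono ?_
  rintro _ ⟨α, hα, rfl⟩
  exact ⟨α, h.trans hα, rfl⟩

theorem tailSpan_pow {n : ℕ} {F : Type} [NormedAddCommGroup F] [InnerProductSpace ℂ F]
    (Sm : Fin n → F →L[ℂ] F) {X : F →L[ℂ] F} (hX : X ∈ tailSpan Sm 1) (k : ℕ) :
    X ^ (k + 1) ∈ tailSpan Sm (k + 1) := by
  induction k with
  | zero => simpa using hX
  | succ k ih => rw [pow_succ]; exact tailSpan_mul Sm ih hX

theorem wordProd_eq_zero {n m : ℕ} {F : Type} [NormedAddCommGroup F] [InnerProductSpace ℂ F]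
    (e : HilbertBasis (Word n) ℂ F) (Sm : Fin n → F →L[ℂ] F)
    (hSm : ∀ (i : Fin n) (α : Word n),
      Sm i (e α) = if wordLen α < m then e (FreeMonoid.of i * α) else 0)
    (α : Word n) (hα : m < wordLen α) : wordProd Sm α = 0 := by
  have key : ∀ (l : List (Fin n)) (β : Word n),
      (l.map Sm).prod (e β) = 0 ∨
        ∃ γ : Word n, wordLen γ = l.length + wordLen β ∧ (l.map Sm).prod (e β) = e γ := by
    intro l β
    induction l with
    | nil => right; exact ⟨β, by simp, by simp⟩
    | cons i l ih =>
      rw [List.map_cons, List.prod_cons, ContinuousLinearMap.mul_apply]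
      rcases ih with h | ⟨γ, hγ, h⟩
      · left; rw [h, map_zero]
      · rw [h, hSm]
        split_ifs
        · right
          refine ⟨_, ?_, rfl⟩
          rw [wordLen_mul, hγ]
          simp [wordLen]; omega
        · left; rfl
  have hd : Dense (Submodule.span ℂ (Set.range e) : Set F) := by
    rw [Submodule.dense_iff_topologicalClosure_eq_top]; exact e.dense_span
  refine ContinuousLinearMap.ext_on hd ?_
  rintro _ ⟨β, rfl⟩
  unfold wordProd
  unfold wordLen at hα
  cases hl : FreeMonoid.toList α with
  | nil => rw [hl] at hα; simp at hα
  | cons i l =>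
    rw [hl] at hα
    rw [List.map_cons, List.prod_cons, ContinuousLinearMap.mul_apply]
    rcases key l β with h | ⟨γ, hγ, h⟩
    · simp [h]
    · rw [h, hSm, if_neg]
      · simp
      · simp at hα; omega

theorem tailSpan_eq_zero {n m : ℕ} {F : Type} [NormedAddCommGroup F] [InnerProductSpace ℂ F]
    (e : HilbertBasis (Word n) ℂ F) (Sm : Fin n → F →L[ℂ] F)
    (hSm : ∀ (i : Fin n) (α : Word n),
      Sm i (e α) = if wordLen α < m then e (FreeMonoid.of i * α) else 0)
    {X : F →L[ℂ] F} (hX : X ∈ tailSpan Sm (m + 1)) : X = 0 := by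
  have : tailSpan Sm (m + 1) ≤ ⊥ := by
    refine Submodule.span_le.2 ?_
    rintro _ ⟨α, hα, rfl⟩
    simp [wordProd_eq_zero e Sm hSm α hα]
  simpa using this hX

theorem mem_truncSpace_iff {n m : ℕ} {F : Type} [NormedAddCommGroup F] [InnerProductSpace ℂ F]
    (e : HilbertBasis (Word n) ℂ F) (Sm : Fin n → F →L[ℂ] F)
    (hSm : ∀ (i : Fin n) (α : Word n),
      Sm i (e α) = if wordLen α < m then e (FreeMonoid.of i * α) else 0)
    {X : F →L[ℂ] F} : X ∈ truncSpace m Sm ↔ X ∈ tailSpan Sm 1 := by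
  classical
  constructor
  · rintro ⟨c, rfl⟩
    refine Submodule.sum_mem _ fun k hk => Submodule.sum_mem _ fun f _ =>
      Submodule.smul_mem _ _ (Submodule.subset_span ⟨word f, ?_, rfl⟩)
    rw [wordLen_word]
    exact (Finset.mem_Icc.1 hk).1
  · intro h
    induction h using Submodule.span_induction with
    | mem x hx =>
      obtain ⟨α, hα, rfl⟩ := hx
      by_cases hm : wordLen α ≤ m
      · refine ⟨Pi.single α 1, ?_⟩
        obtain ⟨f, hf⟩ := exists_word α
        rw [Finset.sum_eq_single (wordLen α)]
        · unfold truncSum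
          rw [Finset.sum_eq_single f]
          · rw [hf]; simp
          · intro g _ hg
            rw [Pi.single_eq_of_ne, zero_smul]
            intro hga
            exact hg (word_inj (hga.trans hf.symm))
          · simp
        · intro k _ hk
          refine Finset.sum_eq_zero fun g _ => ?_
          rw [Pi.single_eq_of_ne, zero_smul]
          intro hga
          exact hk (by rw [← hga, wordLen_word])
        · intro h
          exact absurd (Finset.mem_Icc.2 ⟨hα, hm⟩) h
      · refine ⟨0, ?_⟩
        rw [wordProd_eq_zero e Sm hSm α (by omega)]
        simp [truncSum]
    | zero => exact ⟨0, by simp [truncSum]⟩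
    | add x y _ _ hx hy =>
      obtain ⟨c, rfl⟩ := hx
      obtain ⟨d, rfl⟩ := hy
      refine ⟨c + d, ?_⟩
      simp [truncSum, add_smul, Finset.sum_add_distrib]
    | smul a x _ hx =>
      obtain ⟨c, rfl⟩ := hx
      refine ⟨a • c, ?_⟩
      simp [truncSum, mul_smul, Finset.smul_sum]

theorem cayley_mem {n m : ℕ} {F : Type} [NormedAddCommGroup F] [InnerProductSpace ℂ F]
    (e : HilbertBasis (Word n) ℂ F) (Sm : Fin n → F →L[ℂ] F)
    (hSm : ∀ (i : Fin n) (α : Word n),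
      Sm i (e α) = if wordLen α < m then e (FreeMonoid.of i * α) else 0)
    {X : F →L[ℂ] F} (hX : X ∈ tailSpan Sm 1) :
    IsUnit (1 - X) ∧ X * Ring.inverse (1 - X) ∈ tailSpan Sm 1 := by
  have h0 : X ^ (m + 1) = 0 := tailSpan_eq_zero e Sm hSm (tailSpan_pow Sm hX m)
  have hu : IsUnit (1 - X) := IsNilpotent.isUnit_one_sub ⟨_, h0⟩
  refine ⟨hu, ?_⟩
  have hg : (∑ i ∈ Finset.range (m + 1), X ^ i) * (1 - X) = 1 := by
    rw [geom_sum_mul_neg, h0, sub_zero]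
  have hi : Ring.inverse (1 - X) = ∑ i ∈ Finset.range (m + 1), X ^ i := by
    calc Ring.inverse (1 - X)
        = (∑ i ∈ Finset.range (m + 1), X ^ i) * (1 - X) * Ring.inverse (1 - X) := by
          rw [hg, one_mul]
      _ = _ := by rw [mul_assoc, Ring.mul_inverse_cancel _ hu, mul_one]
  rw [hi, Finset.mul_sum]
  refine Submodule.sum_mem _ fun i _ => ?_
  rw [← pow_succ']
  exact tailSpan_anti Sm (by omega) (tailSpan_pow Sm hX i)

theorem pos_iff_norm {F : Type} [NormedAddCommGroup F] [InnerProductSpace ℂ F] [CompleteSpace F]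
    (Y : F →L[ℂ] F) :
    (adjoint Y + 1 + Y).IsPositive ↔ ∀ x, ‖Y x‖ ≤ ‖x + Y x‖ := by
  have hsa : IsSelfAdjoint (adjoint Y + 1 + Y) := by
    rw [IsSelfAdjoint, ← ContinuousLinearMap.star_eq_adjoint]
    simp only [star_add, star_star, star_one]
    abel
  rw [ContinuousLinearMap.isPositive_def']
  have hkey : ∀ x, (adjoint Y + 1 + Y).reApplyInnerSelf x = ‖x + Y x‖ ^ 2 - ‖Y x‖ ^ 2 := by
    intro x
    rw [ContinuousLinearMap.reApplyInnerSelf_apply, @norm_add_sq ℂ]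
    simp only [ContinuousLinearMap.add_apply, inner_add_left, map_add,
      ContinuousLinearMap.adjoint_inner_left, ContinuousLinearMap.one_apply]
    rw [inner_re_symm (Y x) x, inner_self_eq_norm_sq]
    ring
  constructor
  · rintro ⟨_, h⟩ x
    have := h x
    rw [hkey] at this
    exact le_of_sq_le_sq (by linarith) (norm_nonneg _)
  · intro h
    refine ⟨hsa, fun x => ?_⟩
    rw [hkey]
    have := pow_le_pow_left₀ (norm_nonneg _) (h x) 2
    linarith

theorem pos_iff_contraction {F : Type} [NormedAddCommGroup F] [InnerProductSpace ℂ F]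
    [CompleteSpace F] (X Y : F →L[ℂ] F) (hu : IsUnit (1 - X)) (h : Y * (1 - X) = X) :
    (adjoint Y + 1 + Y).IsPositive ↔ ‖X‖ ≤ 1 := by
  have hY : ∀ z, Y ((1 - X) z) = X z := fun z => by
    rw [← ContinuousLinearMap.mul_apply, h]
  have hz : ∀ z, (1 - X) z + X z = z := fun z => by simp
  rw [pos_iff_norm]
  constructor
  · intro H
    refine ContinuousLinearMap.opNorm_le_bound _ zero_le_one fun z => ?_
    have := H ((1 - X) z)
    rwa [hY, hz, ← one_mul ‖z‖] at this
  · intro H x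
    obtain ⟨z, rfl⟩ : ∃ z, (1 - X) z = x := by
      refine ⟨Ring.inverse (1 - X) x, ?_⟩
      rw [← ContinuousLinearMap.mul_apply, Ring.mul_inverse_cancel _ hu,
        ContinuousLinearMap.one_apply]
    rw [hY, hz]
    simpa using X.le_of_opNorm_le H z

theorem cayley_left_inv {R : Type*} [Ring R] (X : R) (hu : IsUnit (1 - X)) :
    (X * Ring.inverse (1 - X)) * Ring.inverse (1 + X * Ring.inverse (1 - X)) = X := by
  have h : 1 + X * Ring.inverse (1 - X) = Ring.inverse (1 - X) := by
    have := Ring.mul_inverse_cancel _ hu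
    rw [sub_mul, one_mul] at this
    exact (sub_eq_iff_eq_add.1 this).symm
  rw [h]
  have hu' : IsUnit (Ring.inverse (1 - X)) := hu.ringInverse
  rw [mul_assoc, Ring.mul_inverse_cancel _ hu', mul_one]

theorem cayley_right_inv {R : Type*} [Ring R] (Y : R) (hu : IsUnit (1 + Y)) :
    (Y * Ring.inverse (1 + Y)) * Ring.inverse (1 - Y * Ring.inverse (1 + Y)) = Y := by
  have h := cayley_left_inv (-Y) (by simpa using hu)
  simp only [sub_neg_eq_add, neg_mul, ← sub_eq_add_neg] at h
  exact neg_injective h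

/-- The truncated Cayley transform `X ↦ X (I − X)⁻¹` maps the closed unit
ball of `N^{(m)}` bijectively onto `{ Y ∈ N^{(m)} : Y* + I + Y ≥ 0 }`, with inverse
`Y ↦ Y (I + Y)⁻¹`.  (Here `Sm i` is the compression `S_i^{(m)}` of the left creation operator
to polynomials of degree `≤ m`, extended by `0`.) -/
theorem stmt_13 (n : ℕ) (hn : 1 ≤ n) (m : ℕ)
    (F : Type) [NormedAddCommGroup F] [InnerProductSpace ℂ F] [CompleteSpace F]
    (e : HilbertBasis (Word n) ℂ F)
    (Sm : Fin n → F →L[ℂ] F)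
    (hSm : ∀ (i : Fin n) (α : Word n),
      Sm i (e α) = if wordLen α < m then e (FreeMonoid.of i * α) else 0) :
    (∀ X ∈ truncSpace m Sm, ‖X‖ ≤ 1 → IsUnit (1 - X)) ∧
    (∀ Y ∈ truncSpace m Sm, IsUnit (1 + Y)) ∧
    Set.BijOn (fun X : F →L[ℂ] F => X * Ring.inverse (1 - X))
      {X | X ∈ truncSpace m Sm ∧ ‖X‖ ≤ 1}
      {Y | Y ∈ truncSpace m Sm ∧ (adjoint Y + 1 + Y).IsPositive} ∧
    Set.InvOn (fun Y : F →L[ℂ] F => Y * Ring.inverse (1 + Y))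
      (fun X : F →L[ℂ] F => X * Ring.inverse (1 - X))
      {X | X ∈ truncSpace m Sm ∧ ‖X‖ ≤ 1}
      {Y | Y ∈ truncSpace m Sm ∧ (adjoint Y + 1 + Y).IsPositive} := by
  have M : ∀ {X}, X ∈ truncSpace m Sm ↔ X ∈ tailSpan Sm 1 := mem_truncSpace_iff e Sm hSm
  have hsub : ∀ X ∈ truncSpace m Sm, IsUnit (1 - X) := fun X hX =>
    (cayley_mem e Sm hSm (M.1 hX)).1
  have hneg : ∀ Y ∈ truncSpace m Sm, -Y ∈ tailSpan Sm 1 := fun Y hY =>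
    Submodule.neg_mem _ (M.1 hY)
  have hadd : ∀ Y ∈ truncSpace m Sm, IsUnit (1 + Y) := fun Y hY => by
    simpa using (cayley_mem e Sm hSm (hneg Y hY)).1
  have hinv : Set.InvOn (fun Y : F →L[ℂ] F => Y * Ring.inverse (1 + Y))
      (fun X : F →L[ℂ] F => X * Ring.inverse (1 - X))
      {X | X ∈ truncSpace m Sm ∧ ‖X‖ ≤ 1}
      {Y | Y ∈ truncSpace m Sm ∧ (adjoint Y + 1 + Y).IsPositive} :=
    ⟨fun X hX => cayley_left_inv X (hsub X hX.1), fun Y hY => cayley_right_inv Y (hadd Y hY.1)⟩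
  refine ⟨fun X hX _ => hsub X hX, hadd, hinv.bijOn ?_ ?_, hinv⟩
  · rintro X ⟨hX, hn⟩
    refine ⟨M.2 (cayley_mem e Sm hSm (M.1 hX)).2, ?_⟩
    refine (pos_iff_contraction X _ (hsub X hX) ?_).2 hn
    rw [mul_assoc, Ring.inverse_mul_cancel _ (hsub X hX), mul_one]
  · rintro Y ⟨hY, hp⟩
    have hm : Y * Ring.inverse (1 + Y) ∈ truncSpace m Sm := by
      have := Submodule.neg_mem _ (cayley_mem e Sm hSm (hneg Y hY)).2
      exact M.2 (by simpa using this)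
    refine ⟨hm, ?_⟩
    refine (pos_iff_contraction _ Y (hsub _ hm) ?_).1 hp
    have hr := cayley_right_inv Y (hadd Y hY)
    nth_rewrite 1 [← hr]
    rw [mul_assoc, Ring.inverse_mul_cancel _ (hsub _ hm), mul_one]

end
end
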